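/- Let G be a finite simple graph, k a positive integer, and w a vertex of G with degree less than k. If any two proper k-colorings of the induced subgraph G − w are Kempe k-equivalent, then any two proper k-colorings of G are Kempe k-equivalent. -/

import Mathlib

namespace KempePaper

variable {V : Type*}

/-- A proper `k`-coloring: adjacent vertices receive distinct colors. -/
def Proper (G : SimpleGraph V) {k : ℕ} (c : V → Fin k) : Prop :=
  ∀ ⦃u v : V⦄, G.Adj u v → c u ≠ c v

/-- The subgraph of `G` induced by the vertices colored `α` or `β` under `c`
(as a graph on all of `V`, with edges only between such vertices). -/
def kempeGraph (G : SimpleGraph V) {k : ℕ} (c : V → Fin k) (α β : Fin k) :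
    SimpleGraph V :=
  SimpleGraph.fromRel (fun u v =>
    G.Adj u v ∧ (c u = α ∨ c u = β) ∧ (c v = α ∨ c v = β))

/-- `c₂` is obtained from `c₁` by a single Kempe swap: the colors `α` and `β`
are interchanged on the connected component (of the subgraph induced by the
vertices colored `α` or `β`) containing some vertex `w`, and nothing else changes. -/
def KempeStep (G : SimpleGraph V) {k : ℕ} (c₁ c₂ : V → Fin k) : Prop :=
  ∃ (α β : Fin k) (w : V),
    (∀ v : V, (kempeGraph G c₁ α β).Reachable w v → c₂ v = Equiv.swap α β (c₁ v)) ∧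
    (∀ v : V, ¬ (kempeGraph G c₁ α β).Reachable w v → c₂ v = c₁ v)

/-- Two `k`-colorings are Kempe `k`-equivalent if one can be obtained from the
other by a finite sequence of Kempe swaps. -/
def KempeEquiv (G : SimpleGraph V) {k : ℕ} (c₁ c₂ : V → Fin k) : Prop :=
  Relation.ReflTransGen (KempeStep G) c₁ c₂

/-- The triangulated toroidal grid `T[a×b]`. -/
def triGrid (a b : ℕ) : SimpleGraph (ZMod a × ZMod b) :=
  SimpleGraph.fromRel (fun u v =>
    u - v ∈ ({(0,1), (0,-1), (1,0), (-1,0), (1,-1), (-1,1)} : Set (ZMod a × ZMod b)))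

/-- `G` is `d`-degenerate: every nonempty finite set `S` of vertices contains a
vertex with at most `d` neighbors inside `S`. -/
def Degenerate (G : SimpleGraph V) (d : ℕ) : Prop :=
  ∀ S : Set V, S.Finite → S.Nonempty → ∃ v ∈ S, (S ∩ G.neighborSet v).ncard ≤ d

/-- `S` is an independent set in `G`. -/
def Indep (G : SimpleGraph V) (S : Set V) : Prop :=
  ∀ u ∈ S, ∀ v ∈ S, ¬ G.Adj u v

/-- The relation identifying all the vertices of `S`. -/
def identifyRel (S : Set V) (u v : V) : Prop :=
  u = v ∨ (u ∈ S ∧ v ∈ S)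

/-- The identification `G/S`: the vertices of `S` are merged into a single vertex,
and two distinct resulting vertices are adjacent iff some representatives are
adjacent in `G`. -/
def Identify (G : SimpleGraph V) (S : Set V) :
    SimpleGraph (Quot (identifyRel S)) :=
  SimpleGraph.fromRel (fun x y =>
    ∃ u v : V, Quot.mk (identifyRel S) u = x ∧ Quot.mk (identifyRel S) v = y ∧ G.Adj u v)

/-- A good 4-template: an independent set of exactly 4 vertices whose
identification yields a 4-degenerate graph. -/
def GoodFourTemplate (G : SimpleGraph V) (S : Set V) : Prop :=
  Indep G S ∧ S.ncard = 4 ∧ Degenerate (Identify G S) 4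

/-- A coloring is monochromatic on `S`. -/
def Mono {k : ℕ} (c : V → Fin k) (S : Set V) : Prop :=
  ∀ u ∈ S, ∀ v ∈ S, c u = c v

/-- `φ` is nice: it is Kempe 5-equivalent to a proper 5-coloring of `T[a×b]`
containing a good 4-template. -/
def Nice (a b : ℕ) (c : ZMod a × ZMod b → Fin 5) : Prop :=
  ∃ c' : ZMod a × ZMod b → Fin 5,
    Proper (triGrid a b) c' ∧ KempeEquiv (triGrid a b) c c' ∧
    ∃ S : Set (ZMod a × ZMod b), GoodFourTemplate (triGrid a b) S ∧ Mono c' S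

/-- The relation identifying the vertices within each color of the template `T`. -/
def contractRel (T : Set (Set V)) (u v : V) : Prop :=
  u = v ∨ ∃ C ∈ T, u ∈ C ∧ v ∈ C

/-- The contraction `G_T`: the vertices within each color of `T` are identified,
and two distinct resulting vertices are adjacent iff some representatives are
adjacent in `G`. -/
def Contract (G : SimpleGraph V) (T : Set (Set V)) :
    SimpleGraph (Quot (contractRel T)) :=
  SimpleGraph.fromRel (fun x y =>
    ∃ u v : V, Quot.mk (contractRel T) u = x ∧ Quot.mk (contractRel T) v = y ∧ G.Adj u v)

/-- `T` is a template in `G`: a finite collection of pairwise disjoint nonempty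
independent sets of vertices. -/
def IsTemplate (G : SimpleGraph V) (T : Set (Set V)) : Prop :=
  T.Finite ∧ (∀ C ∈ T, C.Nonempty) ∧ T.Pairwise (fun C D => Disjoint C D) ∧
    ∀ C ∈ T, Indep G C

/-- A coloring contains the template `T` if each color of `T` is monochromatic. -/
def ContainsTemplate {k : ℕ} (c : V → Fin k) (T : Set (Set V)) : Prop :=
  ∀ C ∈ T, Mono c C


theorem kempeGraph_adj {V : Type*} {G : SimpleGraph V} {k : ℕ} {c : V → Fin k} {α β : Fin k}
    {u v : V} : (kempeGraph G c α β).Adj u v ↔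
      G.Adj u v ∧ (c u = α ∨ c u = β) ∧ (c v = α ∨ c v = β) := by
  simp only [kempeGraph, SimpleGraph.fromRel_adj]
  constructor
  · rintro ⟨-, h | h⟩
    · exact h
    · exact ⟨h.1.symm, h.2.2, h.2.1⟩
  · exact fun h => ⟨h.1.ne, Or.inl h⟩

/-- Kempe swaps preserve properness. -/
theorem KempeStep.proper {V : Type*} {G : SimpleGraph V} {k : ℕ} {c₁ c₂ : V → Fin k}
    (h : KempeStep G c₁ c₂) (h₁ : Proper G c₁) : Proper G c₂ := by
  obtain ⟨α, β, w, hin, hout⟩ := h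
  have mixed : ∀ u v, G.Adj u v → (kempeGraph G c₁ α β).Reachable w u →
      ¬ (kempeGraph G c₁ α β).Reachable w v → c₂ u ≠ c₂ v := by
    intro u v huv hu hv
    have hn : ¬ ((c₁ u = α ∨ c₁ u = β) ∧ (c₁ v = α ∨ c₁ v = β)) := fun hc =>
      hv (hu.trans (SimpleGraph.Adj.reachable (kempeGraph_adj.2 ⟨huv, hc⟩)))
    have hne := h₁ huv
    rw [hin u hu, hout v hv, Equiv.swap_apply_def]
    grind
  intro u v huv
  by_cases hu : (kempeGraph G c₁ α β).Reachable w u <;>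
    by_cases hv : (kempeGraph G c₁ α β).Reachable w v
  · rw [hin u hu, hin v hv]
    exact fun he => h₁ huv ((Equiv.swap α β).injective he)
  · exact mixed u v huv hu hv
  · exact (mixed v u huv.symm hv hu).symm
  · rw [hout u hu, hout v hv]
    exact h₁ huv

/-- Two proper colorings that differ at most at one vertex are related by a Kempe swap. -/
theorem kempeStep_of_eq_off {V : Type*} {G : SimpleGraph V} {k : ℕ} {c₁ c₂ : V → Fin k} {w : V}
    (h₁ : Proper G c₁) (h₂ : Proper G c₂) (h : ∀ v, v ≠ w → c₁ v = c₂ v) :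
    KempeStep G c₁ c₂ := by
  have key : ∀ v, (kempeGraph G c₁ (c₁ w) (c₂ w)).Reachable w v → v = w := by
    intro v hv
    rw [SimpleGraph.reachable_iff_reflTransGen] at hv
    induction hv with
    | refl => rfl
    | tail _ hadj ih =>
      subst ih
      obtain ⟨hG, -, hc⟩ := kempeGraph_adj.1 hadj
      rcases hc with hc | hc
      · exact absurd hc.symm (h₁ hG)
      · rw [h _ hG.ne'] at hc
        exact absurd hc.symm (h₂ hG)
  refine ⟨c₁ w, c₂ w, w, fun v hv => ?_, fun v hv => ?_⟩
  · rw [key v hv, Equiv.swap_apply_left]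
  · exact (h v (by rintro rfl; exact hv (SimpleGraph.Reachable.refl _))).symm

/-- Deleting a vertex with at most one neighbor in a Kempe graph does not change
reachability between the other vertices. -/
theorem reachable_kempeGraph_induce_iff {V : Type*} {G : SimpleGraph V} {k : ℕ} {c : V → Fin k}
    {α β : Fin k} {w : V} (hs : ((kempeGraph G c α β).neighborSet w).Subsingleton)
    (u v : {v : V | v ≠ w}) :
    (kempeGraph (G.induce {v : V | v ≠ w}) (fun x => c x) α β).Reachable u v ↔
      (kempeGraph G c α β).Reachable (u : V) (v : V) := by
  have adj_of : ∀ x y : {v : V | v ≠ w}, (kempeGraph G c α β).Adj (x : V) (y : V) →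
      (kempeGraph (G.induce {v : V | v ≠ w}) (fun x => c x) α β).Adj x y := fun x y h =>
    kempeGraph_adj.2 (kempeGraph_adj.1 h)
  constructor
  · intro h
    exact h.map (G' := kempeGraph G c α β)
      ⟨Subtype.val, fun hxy => by rw [kempeGraph_adj] at hxy ⊢; exact hxy⟩
  · have key : ∀ x : V, (kempeGraph G c α β).Reachable (u : V) x →
        (∀ hx : x ≠ w, (kempeGraph (G.induce {v : V | v ≠ w}) (fun x => c x) α β).Reachable
          u ⟨x, hx⟩) ∧
        (x = w → ∃ y : {v : V | v ≠ w}, (kempeGraph G c α β).Adj w y ∧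
          (kempeGraph (G.induce {v : V | v ≠ w}) (fun x => c x) α β).Reachable u y) := by
      intro x hx
      rw [SimpleGraph.reachable_iff_reflTransGen] at hx
      induction hx with
      | refl => exact ⟨fun _ => SimpleGraph.Reachable.refl _, fun hu => absurd hu u.2⟩
      | @tail x y _ hadj ih =>
        by_cases hxw : x = w
        · obtain ⟨z, hz, huz⟩ := ih.2 hxw
          subst hxw
          refine ⟨fun hy => ?_, fun hy => absurd hy hadj.ne'⟩
          have hzy : z = ⟨y, hy⟩ := Subtype.ext (hs hz hadj)
          exact hzy ▸ huz
        · refine ⟨fun hy => (ih.1 hxw).trans (adj_of ⟨x, hxw⟩ ⟨y, hy⟩ hadj).reachable, ?_⟩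
          rintro rfl
          exact ⟨⟨x, hxw⟩, hadj.symm, ih.1 hxw⟩
    exact fun h => (key v h).1 v.2

/-- If two neighbors of a vertex `w` of degree less than `k` share a color, then some color
other than that of `w` is missing from the neighborhood of `w`. -/
theorem exists_free_color {V : Type*} [Fintype V] {G : SimpleGraph V} {k : ℕ} {c : V → Fin k}
    {w x y : V} (hdeg : (G.neighborSet w).ncard < k) (hx : G.Adj w x) (hy : G.Adj w y)
    (hxy : x ≠ y) (hc : c x = c y) : ∃ ε, ε ≠ c w ∧ ∀ v, G.Adj w v → c v ≠ ε := by
  have himage : c '' G.neighborSet w ⊆ c '' (G.neighborSet w \ {x}) := by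
    rintro _ ⟨v, hv, rfl⟩
    by_cases hvx : v = x
    · exact ⟨y, ⟨hy, hxy.symm⟩, by rw [hvx, hc]⟩
    · exact ⟨v, ⟨hv, hvx⟩, rfl⟩
  have hcard : (insert (c w) (c '' G.neighborSet w)).ncard < k := by
    have hle := Set.ncard_insert_le (c w) (c '' G.neighborSet w)
    have hsub := Set.ncard_le_ncard himage (Set.toFinite _)
    have him := Set.ncard_image_le (f := c) (Set.toFinite (G.neighborSet w \ {x}))
    have hdiff := Set.ncard_sdiff_singleton_add_one (s := G.neighborSet w) hx (Set.toFinite _)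
    omega
  obtain ⟨ε, hε⟩ : ∃ ε, ε ∉ insert (c w) (c '' G.neighborSet w) := by
    by_contra! hall
    rw [Set.eq_univ_of_forall hall, Set.ncard_univ, Nat.card_fin] at hcard
    exact lt_irrefl _ hcard
  simp only [Set.mem_insert_iff, Set.mem_image, not_or, not_exists, not_and] at hε
  exact ⟨ε, hε.1, fun v hv => hε.2 v hv⟩

/-- A Kempe swap in `G - w` lifts to `G` when `w` has at most one neighbor in the Kempe graph. -/
theorem KempeStep.lift_of_subsingleton {V : Type*} {G : SimpleGraph V} {k : ℕ} {c : V → Fin k}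
    {α β : Fin k} {w : V} (hs : ((kempeGraph G c α β).neighborSet w).Subsingleton)
    {u : {v : V | v ≠ w}} {φ : {v : V | v ≠ w} → Fin k}
    (hin : ∀ v, (kempeGraph (G.induce {v : V | v ≠ w}) (fun x => c x) α β).Reachable u v →
      φ v = Equiv.swap α β (c v))
    (hout : ∀ v, ¬ (kempeGraph (G.induce {v : V | v ≠ w}) (fun x => c x) α β).Reachable u v →
      φ v = c v) :
    ∃ c' : V → Fin k, KempeStep G c c' ∧ (fun x : {v : V | v ≠ w} => c' x) = φ := by
  classical
  refine ⟨fun v => if (kempeGraph G c α β).Reachable u v then Equiv.swap α β (c v) else c v,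
    ⟨α, β, u, fun v hv => if_pos hv, fun v hv => if_neg hv⟩, ?_⟩
  funext v
  have hiff := reachable_kempeGraph_induce_iff hs u v
  by_cases hv : (kempeGraph G c α β).Reachable (u : V) (v : V)
  · simp only [if_pos hv, hin v (hiff.2 hv)]
  · simp only [if_neg hv, hout v (fun h => hv (hiff.1 h))]

/-- A Kempe swap in `G - w` lifts to a sequence of Kempe swaps in `G`. -/
theorem KempeStep.lift {V : Type*} [Fintype V] {G : SimpleGraph V} {k : ℕ} {w : V}
    (hdeg : (G.neighborSet w).ncard < k) {c : V → Fin k} (hc : Proper G c)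
    {φ : {v : V | v ≠ w} → Fin k}
    (h : KempeStep (G.induce {v : V | v ≠ w}) (fun x => c x) φ) :
    ∃ c' : V → Fin k, KempeEquiv G c c' ∧ Proper G c' ∧
      (fun x : {v : V | v ≠ w} => c' x) = φ := by
  classical
  obtain ⟨α, β, u, hin, hout⟩ := h
  by_cases hs : ((kempeGraph G c α β).neighborSet w).Subsingleton
  · obtain ⟨c', hstep, hres⟩ := KempeStep.lift_of_subsingleton hs hin hout
    exact ⟨c', Relation.ReflTransGen.single hstep, hstep.proper hc, hres⟩
  · obtain ⟨x, hx, y, hy, hxy⟩ := Set.not_subsingleton_iff.1 hs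
    obtain ⟨hGx, hw, hcx⟩ := kempeGraph_adj.1 hx
    obtain ⟨hGy, -, hcy⟩ := kempeGraph_adj.1 hy
    have hwx := hc hGx
    have hwy := hc hGy
    obtain ⟨ε, hεw, hε⟩ := exists_free_color hdeg hGx hGy hxy (c := c) (by grind)
    have hεx := hε x hGx
    have hεα : ε ≠ α := by grind
    have hεβ : ε ≠ β := by grind
    have hd : Proper G (Function.update c w ε) := by
      intro a b hab
      by_cases ha : a = w
      · subst ha
        rw [Function.update_self, Function.update_of_ne hab.ne']
        exact (hε b hab).symm
      · rw [Function.update_of_ne ha]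
        by_cases hb : b = w
        · subst hb
          rw [Function.update_self]
          exact hε a hab.symm
        · rw [Function.update_of_ne hb]
          exact hc hab
    have hstep₁ : KempeStep G c (Function.update c w ε) :=
      kempeStep_of_eq_off hc hd fun v hv => (Function.update_of_ne hv ε c).symm
    have hres₁ : (fun x : {v : V | v ≠ w} => c x) =
        fun x : {v : V | v ≠ w} => Function.update c w ε x :=
      funext fun v => (Function.update_of_ne v.2 ε c).symm
    have hs' : ((kempeGraph G (Function.update c w ε) α β).neighborSet w).Subsingleton := by
      intro a ha
      have hcol := (kempeGraph_adj.1 ha).2.1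
      rw [Function.update_self] at hcol
      exact (hcol.elim hεα hεβ).elim
    rw [hres₁] at hin hout
    obtain ⟨c', hstep₂, hres₂⟩ := KempeStep.lift_of_subsingleton hs' hin hout
    exact ⟨c', (Relation.ReflTransGen.single hstep₁).tail hstep₂, hstep₂.proper hd, hres₂⟩

/-- A sequence of Kempe swaps in `G - w` lifts to `G`. -/
theorem KempeEquiv.lift {V : Type*} [Fintype V] {G : SimpleGraph V} {k : ℕ} {w : V}
    (hdeg : (G.neighborSet w).ncard < k) {c : V → Fin k} (hc : Proper G c)
    {φ : {v : V | v ≠ w} → Fin k}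
    (h : KempeEquiv (G.induce {v : V | v ≠ w}) (fun x => c x) φ) :
    ∃ c' : V → Fin k, KempeEquiv G c c' ∧ Proper G c' ∧
      (fun x : {v : V | v ≠ w} => c' x) = φ := by
  induction h with
  | refl => exact ⟨c, Relation.ReflTransGen.refl, hc, rfl⟩
  | tail _ hstep ih =>
    obtain ⟨d, hcd, hd, rfl⟩ := ih
    obtain ⟨c', hdc', hc', hres⟩ := hstep.lift hdeg hd
    exact ⟨c', hcd.trans hdc', hc', hres⟩

/-- If `w` has degree less than `k` and all proper `k`-colorings of
`G − w` are Kempe `k`-equivalent, then all proper `k`-colorings of `G` are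
Kempe `k`-equivalent. -/
theorem statement_1 {V : Type*} [Fintype V] (G : SimpleGraph V) (k : ℕ) (hk : 0 < k)
    (w : V) (hdeg : (G.neighborSet w).ncard < k)
    (hGw : ∀ c₁ c₂ : {v : V | v ≠ w} → Fin k,
      Proper (G.induce {v : V | v ≠ w}) c₁ → Proper (G.induce {v : V | v ≠ w}) c₂ →
      KempeEquiv (G.induce {v : V | v ≠ w}) c₁ c₂)
    (c₁ c₂ : V → Fin k) (h₁ : Proper G c₁) (h₂ : Proper G c₂) :
    KempeEquiv G c₁ c₂ := by
  obtain ⟨c', hequiv, hc', hres⟩ := KempeEquiv.lift hdeg h₁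
    (hGw (fun x => c₁ x) (fun x => c₂ x) (fun _ _ h => h₁ h) (fun _ _ h => h₂ h))
  exact hequiv.tail (kempeStep_of_eq_off hc' h₂ fun v hv => congrFun hres ⟨v, hv⟩)

end KempePaper
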